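/- Let X be a real random variable whose characteristic function g_X(t) = E exp{itX} satisfies ∫_{-∞}^{∞} |g_X(t)| dt = A < ∞. Let m ≥ 2 and f(x) = x^m + α_{m-1}x^{m-1} + ... + α_0 be a monic polynomial of degree m. Then there exists a constant c, not depending on t, such that for all |t| ≥ 1, |E exp{i t f(X)}| ≤ c A |t|^{-1/m}. -/

import Mathlib

open MeasureTheory ProbabilityTheory Filter Set

lemma vdc_base (p : Polynomial ℝ) (a b μ : ℝ) (hab : a ≤ b) (hμ : 0 < μ)
    (h1 : ∀ x ∈ Icc a b, μ ≤ |p.derivative.eval x|)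
    (h2 : (∀ x ∈ Icc a b, 0 ≤ p.derivative.derivative.eval x) ∨
      (∀ x ∈ Icc a b, p.derivative.derivative.eval x ≤ 0)) :
    ‖∫ x in a..b, Complex.exp (Complex.I * ((p.eval x : ℝ) : ℂ))‖ ≤ 4 / μ := by
  have hne : ∀ x ∈ Icc a b, p.derivative.eval x ≠ 0 := by
    intro x hx h
    have := h1 x hx
    rw [h, abs_zero] at this
    linarith
  have hinv : ∀ x ∈ Icc a b, |(p.derivative.eval x)⁻¹| ≤ 1 / μ := by
    intro x hx
    rw [abs_inv, ← one_div]
    exact one_div_le_one_div_of_le hμ (h1 x hx)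
  set d : ℝ → ℝ := fun x => p.derivative.derivative.eval x / (p.derivative.eval x)^2 with hd
  have hdc : ContinuousOn d (Icc a b) := by
    apply ContinuousOn.div (by fun_prop) (by fun_prop)
    intro x hx
    exact pow_ne_zero _ (hne x hx)
  have hD : ∀ x ∈ Icc a b, HasDerivAt (fun y => (p.derivative.eval y)⁻¹) (-d x) x := by
    intro x hx
    have := (p.derivative.hasDerivAt x).inv (hne x hx)
    refine this.congr_deriv ?_
    simp only [hd]; ring
  have hDint : ∫ x in a..b, -d x = (p.derivative.eval b)⁻¹ - (p.derivative.eval a)⁻¹ := by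
    apply intervalIntegral.integral_eq_sub_of_hasDerivAt
    · intro x hx
      rw [uIcc_of_le hab] at hx
      exact hD x hx
    · apply ContinuousOn.intervalIntegrable
      rw [uIcc_of_le hab]
      exact hdc.neg
  have ha := hinv a (left_mem_Icc.2 hab)
  have hb := hinv b (right_mem_Icc.2 hab)
  have hdabs : ∫ x in a..b, |d x| ≤ 2 / μ := by
    have e2 : 2 / μ = 1 / μ + 1 / μ := by ring
    rw [intervalIntegral.integral_neg] at hDint
    rw [abs_le] at ha hb
    rcases h2 with h2 | h2
    · have : ∫ x in a..b, |d x| = ∫ x in a..b, d x := by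
        apply intervalIntegral.integral_congr
        intro x hx
        rw [uIcc_of_le hab] at hx
        exact abs_of_nonneg (div_nonneg (h2 x hx) (sq_nonneg _))
      rw [this]; linarith
    · have : ∫ x in a..b, |d x| = ∫ x in a..b, -d x := by
        apply intervalIntegral.integral_congr
        intro x hx
        rw [uIcc_of_le hab] at hx
        exact abs_of_nonpos (div_nonpos_of_nonpos_of_nonneg (h2 x hx) (sq_nonneg _))
      rw [this, intervalIntegral.integral_neg]; linarith
  set E : ℝ → ℂ := fun x => Complex.exp (Complex.I * ((p.eval x : ℝ) : ℂ)) with hE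
  have hEn : ∀ x, ‖E x‖ = 1 := by
    intro x; rw [hE]; simp only [mul_comm Complex.I]; exact Complex.norm_exp_ofReal_mul_I _
  have hEc : Continuous E := by
    simp only [hE]; fun_prop
  set F : ℝ → ℂ := fun x => -Complex.I * (((p.derivative.eval x)⁻¹ : ℝ) : ℂ) * E x with hF
  have hFd : ∀ x ∈ Icc a b, HasDerivAt F (E x + Complex.I * (d x : ℂ) * E x) x := by
    intro x hx
    have e1 : HasDerivAt E (Complex.exp (Complex.I * ((p.eval x : ℝ) : ℂ)) * (Complex.I * ((p.derivative.eval x : ℝ) : ℂ))) x :=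
      (((p.hasDerivAt x).ofReal_comp).const_mul Complex.I).cexp
    have e2 := (((hD x hx).ofReal_comp).const_mul (-Complex.I)).mul e1
    refine e2.congr_deriv ?_
    have h0 : ((p.derivative.eval x : ℝ) : ℂ) ≠ 0 := by exact_mod_cast hne x hx
    simp only [hE]
    push_cast
    field_simp
    linear_combination (-1 : ℂ) * Complex.I_sq 
  have hFint : ∫ x in a..b, (E x + Complex.I * (d x : ℂ) * E x) = F b - F a := by
    apply intervalIntegral.integral_eq_sub_of_hasDerivAt
    · intro x hx
      rw [uIcc_of_le hab] at hx
      exact hFd x hx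
    · apply ContinuousOn.intervalIntegrable
      rw [uIcc_of_le hab]
      fun_prop
  rw [intervalIntegral.integral_add (hEc.intervalIntegrable _ _) (by
      apply ContinuousOn.intervalIntegrable
      rw [uIcc_of_le hab]
      fun_prop)] at hFint
  have hFn : ∀ x ∈ Icc a b, ‖F x‖ ≤ 1 / μ := by
    intro x hx
    simp only [hF, norm_mul, hEn, norm_neg, Complex.norm_I, Complex.norm_real, one_mul, mul_one]
    exact hinv x hx
  have hrest : ‖∫ x in a..b, Complex.I * (d x : ℂ) * E x‖ ≤ 2 / μ := by
    refine (intervalIntegral.norm_integral_le_integral_norm hab).trans ?_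
    simpa [hEn] using hdabs
  have : ∫ x in a..b, E x = F b - F a - ∫ x in a..b, Complex.I * (d x : ℂ) * E x := by
    rw [← hFint]; ring
  rw [this]
  calc _ ≤ ‖F b‖ + ‖F a‖ + ‖∫ x in a..b, Complex.I * (d x : ℂ) * E x‖ :=
        (norm_sub_le _ _).trans (by gcongr; exact norm_sub_le _ _)
    _ ≤ 1 / μ + 1 / μ + 2 / μ := by
        gcongr
        · exact hFn b (right_mem_Icc.2 hab)
        · exact hFn a (left_mem_Icc.2 hab)
    _ = 4 / μ := by ring

lemma neg_norm (p : Polynomial ℝ) (a b : ℝ) :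
    ‖∫ x in a..b, Complex.exp (Complex.I * (((-p).eval x : ℝ) : ℂ))‖ =
    ‖∫ x in a..b, Complex.exp (Complex.I * ((p.eval x : ℝ) : ℂ))‖ := by
  rw [← Complex.norm_conj (∫ x in a..b, Complex.exp (Complex.I * ((p.eval x : ℝ) : ℂ))),
    intervalIntegral, intervalIntegral, map_sub, ← integral_conj, ← integral_conj]
  simp [← Complex.exp_conj]

lemma cross (ψ : ℝ → ℝ) (hψ : Continuous ψ) (a b l : ℝ) (hab : a ≤ b)
    (h : ∀ x ∈ Icc a b, ∀ y ∈ Icc a b, x ≤ y → l * (y - x) ≤ ψ y - ψ x) :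
    ∃ c ∈ Icc a b, (∀ x ∈ Icc a b, c < x → l * (x - c) ≤ ψ x) ∧
      (∀ x ∈ Icc a b, x < c → ψ x ≤ - (l * (c - x))) := by
  have ha := left_mem_Icc.2 hab
  have hb := right_mem_Icc.2 hab
  by_cases h1 : 0 ≤ ψ a
  · refine ⟨a, ha, fun x hx _ => ?_, fun x hx hxa => absurd hx.1 (not_le.2 hxa)⟩
    have := h a ha x hx hx.1
    linarith
  by_cases h2 : ψ b ≤ 0
  · refine ⟨b, hb, fun x hx hxa => absurd hx.2 (not_le.2 hxa), fun x hx _ => ?_⟩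
    have := h x hx b hb hx.2
    linarith
  push Not at h1 h2
  obtain ⟨c, hc, hc0⟩ := intermediate_value_Icc hab hψ.continuousOn ⟨h1.le, h2.le⟩
  refine ⟨c, hc, fun x hx hcx => ?_, fun x hx hxc => ?_⟩
  · have := h c hc x hx hcx.le
    linarith
  · have := h x hx c hc hxc.le
    linarith

lemma vdc (k : ℕ) : ∃ C : ℝ, 0 < C ∧ ∀ (p : Polynomial ℝ) (a b μ : ℝ), a ≤ b → 0 < μ →
    ((∀ x ∈ Icc a b, μ ^ (k+1) ≤ (Polynomial.derivative^[k+1] p).eval x) ∨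
     (∀ x ∈ Icc a b, (Polynomial.derivative^[k+1] p).eval x ≤ -μ ^ (k+1))) →
    (k = 0 → ((∀ x ∈ Icc a b, 0 ≤ p.derivative.derivative.eval x) ∨
      (∀ x ∈ Icc a b, p.derivative.derivative.eval x ≤ 0))) →
    ‖∫ x in a..b, Complex.exp (Complex.I * ((p.eval x : ℝ) : ℂ))‖ ≤ C / μ := by
  induction k with
  | zero =>
    refine ⟨4, by norm_num, fun p a b μ hab hμ h h2 => ?_⟩
    refine vdc_base p a b μ hab hμ (fun x hx => ?_) (h2 rfl)
    simp only [zero_add, pow_one, Function.iterate_one] at h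
    rcases h with h | h
    · exact le_abs.2 (Or.inl (h x hx))
    · exact le_abs.2 (Or.inr (by linarith [h x hx]))
  | succ k ih =>
    obtain ⟨C, hC, ih⟩ := ih
    have main : ∀ (p : Polynomial ℝ) (a b μ : ℝ), a ≤ b → 0 < μ →
        (∀ x ∈ Icc a b, μ ^ (k+2) ≤ (Polynomial.derivative^[k+2] p).eval x) →
        ‖∫ x in a..b, Complex.exp (Complex.I * ((p.eval x : ℝ) : ℂ))‖ ≤ (C + 2 + C) / μ := by
      intro p a b μ hab hμ h
      set q := Polynomial.derivative^[k+1] p with hq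
      have hq' : ∀ x ∈ Icc a b, μ ^ (k+2) ≤ q.derivative.eval x := by
        intro x hx
        rw [hq, ← Function.iterate_succ_apply' (f := Polynomial.derivative)]
        exact h x hx
      have hinc : ∀ x ∈ Icc a b, ∀ y ∈ Icc a b, x ≤ y →
          μ ^ (k+2) * (y - x) ≤ q.eval y - q.eval x := by
        apply (convex_Icc a b).mul_sub_le_image_sub_of_le_deriv q.continuous.continuousOn
          q.differentiable.differentiableOn
        intro x hx
        rw [Polynomial.deriv]
        exact hq' x (interior_subset hx)
      obtain ⟨c, hc, hr, hl⟩ := cross (fun x => q.eval x) q.continuous a b _ hab hinc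
      have hμ' : 0 < 1 / μ := by positivity
      have hmu : μ ^ (k+2) * (1 / μ) = μ ^ (k+1) := by field_simp; ring
      set c1 := max a (c - 1/μ) with hc1
      set c2 := min b (c + 1/μ) with hc2
      have a1 : a ≤ c1 := le_max_left _ _
      have a2 : c1 ≤ c := max_le hc.1 (by linarith)
      have a3 : c ≤ c2 := le_min hc.2 (by linarith)
      have a4 : c2 ≤ b := min_le_left _ _
      have hk0 : ∀ a' b', a ≤ a' → b' ≤ b → (k = 0 → ((∀ x ∈ Icc a' b', 0 ≤ p.derivative.derivative.eval x) ∨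
          (∀ x ∈ Icc a' b', p.derivative.derivative.eval x ≤ 0))) := by
        intro a' b' h1 h2 hk
        left
        intro x hx
        subst hk
        exact (by positivity : 0 ≤ μ ^ 2).trans (h x ⟨h1.trans hx.1, hx.2.trans h2⟩)
      have hcont : Continuous fun x : ℝ => Complex.exp (Complex.I * ((p.eval x : ℝ) : ℂ)) := by
        fun_prop
      have b1 : ‖∫ x in a..c1, Complex.exp (Complex.I * ((p.eval x : ℝ) : ℂ))‖ ≤ C / μ := by
        rcases a1.eq_or_lt with e | e
        · rw [← e]; simp; positivity
        apply ih p a c1 μ a1 hμ _ (hk0 _ _ le_rfl (by linarith))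
        right
        intro x hx
        have e' : c1 = c - 1/μ := by
          rcases max_choice a (c - 1/μ) with h | h
          · exact absurd h (by rw [← hc1]; exact e.ne')
          · exact h
        have := hl x ⟨hx.1, by linarith [hx.2]⟩ (by linarith [hx.2])
        have h3 : μ ^ (k+2) * (1 / μ) ≤ μ ^ (k+2) * (c - x) := by
          gcongr; linarith [hx.2]
        rw [hmu] at h3
        linarith
      have b3 : ‖∫ x in c2..b, Complex.exp (Complex.I * ((p.eval x : ℝ) : ℂ))‖ ≤ C / μ := by
        rcases a4.eq_or_lt with e | e
        · rw [e]; simp; positivity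
        apply ih p c2 b μ a4 hμ _ (hk0 _ _ (by linarith) le_rfl)
        left
        intro x hx
        have e' : c2 = c + 1/μ := by
          rcases min_choice b (c + 1/μ) with h | h
          · exact absurd h (by rw [← hc2]; exact e.ne)
          · exact h
        have := hr x ⟨by linarith [hx.1], hx.2⟩ (by linarith [hx.1])
        have h3 : μ ^ (k+2) * (1 / μ) ≤ μ ^ (k+2) * (x - c) := by
          gcongr; linarith [hx.1]
        rw [hmu] at h3
        linarith
      have b2 : ‖∫ x in c1..c2, Complex.exp (Complex.I * ((p.eval x : ℝ) : ℂ))‖ ≤ 2 / μ := by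
        have := intervalIntegral.norm_integral_le_of_norm_le_const (a := c1) (b := c2) (C := 1)
          (f := fun x : ℝ => Complex.exp (Complex.I * ((p.eval x : ℝ) : ℂ))) (by
            intro x _
            rw [mul_comm]; exact (Complex.norm_exp_ofReal_mul_I _).le)
        refine this.trans ?_
        rw [abs_of_nonneg (by linarith), one_mul]
        have e1 : c - 1/μ ≤ c1 := le_max_right _ _
        have e2 : c2 ≤ c + 1/μ := min_le_right _ _
        have e3 : 2 / μ = 1 / μ + 1 / μ := by ring
        linarith
      have hi := fun u v => hcont.intervalIntegrable (μ := volume) u v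
      rw [← intervalIntegral.integral_add_adjacent_intervals (hi a c2) (hi c2 b),
        ← intervalIntegral.integral_add_adjacent_intervals (hi a c1) (hi c1 c2)]
      refine (norm_add₃_le).trans ?_
      rw [add_div, add_div]
      linarith
    refine ⟨C + 2 + C, by positivity, fun p a b μ hab hμ h _ => ?_⟩
    rcases h with h | h
    · exact main p a b μ hab hμ h
    · rw [← neg_norm]
      apply main (-p) a b μ hab hμ
      intro x hx
      have := h x hx
      rw [Polynomial.iterate_derivative_neg, Polynomial.eval_neg]
      linarith

lemma osc (m : ℕ) (hm : 2 ≤ m) (α : ℕ → ℝ) : ∃ C : ℝ, 0 < C ∧ ∀ t : ℝ, 1 ≤ |t| → ∀ s a b : ℝ,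
    a ≤ b →
    ‖∫ x in a..b, Complex.exp (Complex.I * ((t * (x ^ m + ∑ j ∈ Finset.range m, α j * x ^ j) - s * x : ℝ) : ℂ))‖
      ≤ C * |t| ^ (-(1:ℝ) / m) := by
  obtain ⟨k, rfl⟩ : ∃ k, m = k + 1 := ⟨m - 1, by omega⟩
  obtain ⟨C, hC, h⟩ := vdc k
  refine ⟨C, hC, fun t ht s a b hab => ?_⟩
  have ht0 : 0 < |t| := by linarith
  set q : Polynomial ℝ := Polynomial.C t * (Polynomial.X ^ (k+1) +
    ∑ j ∈ Finset.range (k+1), Polynomial.C (α j) * Polynomial.X ^ j) - Polynomial.C s * Polynomial.X with hq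
  have hqe : ∀ x, q.eval x = t * (x ^ (k+1) + ∑ j ∈ Finset.range (k+1), α j * x ^ j) - s * x := by
    intro x; simp [hq, Polynomial.eval_finsetSum]
  have hqd : Polynomial.derivative^[k+1] q = Polynomial.C (t * (k+1).factorial) := by
    have e1 : Polynomial.derivative^[k+1] (∑ j ∈ Finset.range (k+1), Polynomial.C (α j) * Polynomial.X ^ j) = 0 := by
      rw [Polynomial.iterate_derivative_sum]
      apply Finset.sum_eq_zero
      intro j hj
      apply Polynomial.iterate_derivative_eq_zero
      exact (Polynomial.natDegree_C_mul_X_pow_le _ _).trans_lt (Finset.mem_range.1 hj)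
    have e2 : Polynomial.derivative^[k+1] (Polynomial.C s * Polynomial.X) = 0 := by
      apply Polynomial.iterate_derivative_eq_zero
      have := Polynomial.natDegree_C_mul_X_pow_le s 1
      rw [pow_one] at this
      omega
    rw [hq, Polynomial.iterate_derivative_sub, e2, Polynomial.iterate_derivative_C_mul,
      iterate_map_add, e1, Polynomial.iterate_derivative_X_pow_eq_smul,
      Nat.descFactorial_self]
    simp [mul_comm]
  have hf : (1:ℝ) ≤ (k+1).factorial := by exact_mod_cast Nat.one_le_iff_ne_zero.2 (Nat.factorial_ne_zero _)
  have hpow : (|t| ^ ((1:ℝ) / (k+1 : ℕ))) ^ (k+1) = |t| := by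
    rw [one_div]; exact Real.rpow_inv_natCast_pow ht0.le (by omega)
  have := h q a b (|t| ^ ((1:ℝ) / (k+1 : ℕ))) hab (by positivity) (by
    rw [hpow, hqd]
    rcases le_total 0 t with h0 | h0
    · left; intro x _; rw [abs_of_nonneg h0]; simp; nlinarith
    · right; intro x _; rw [abs_of_nonpos h0]; simp; nlinarith) (by omega)
  simp only [hqe] at this
  rw [neg_div, Real.rpow_neg ht0.le, ← div_eq_mul_inv]
  exact this

lemma pdf_eq (v : NNReal) (hv : v ≠ 0) (y x : ℝ) :
    ((gaussianPDFReal y v x : ℝ) : ℂ) = (((√(2 * Real.pi * v))⁻¹ : ℝ) : ℂ) *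
      ∫ s : ℝ, Complex.exp (Complex.I * s * y) * Complex.exp (-(Complex.I * s * x)) ∂(gaussianReal 0 v⁻¹) := by
  have h := charFun_gaussianReal (μ := 0) (v := v⁻¹) (y - x)
  rw [charFun_apply_real] at h
  have h2 : ∫ s : ℝ, Complex.exp (Complex.I * s * y) * Complex.exp (-(Complex.I * s * x)) ∂(gaussianReal 0 v⁻¹)
     = ∫ s : ℝ, Complex.exp (((y - x : ℝ) : ℂ) * s * Complex.I) ∂(gaussianReal 0 v⁻¹) := by
    congr 1; ext s; rw [← Complex.exp_add]; congr 1; push_cast; ring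
  rw [h2, h, gaussianPDFReal]
  push_cast
  congr 2
  have : (v : ℂ) ≠ 0 := by exact_mod_cast hv
  field_simp
  ring

section
variable {Ω : Type*} [MeasurableSpace Ω] (P : Measure Ω) [IsProbabilityMeasure P]
    (X : Ω → ℝ)

lemma nexp (s y : ℝ) : ‖Complex.exp (Complex.I * s * y)‖ = 1 := by
  rw [show Complex.I * (s:ℂ) * y = ((s * y : ℝ) : ℂ) * Complex.I by push_cast; ring]
  exact Complex.norm_exp_ofReal_mul_I _

lemma nexp' (s y : ℝ) : ‖Complex.exp (-(Complex.I * s * y))‖ = 1 := by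
  rw [show -(Complex.I * (s:ℂ) * y) = ((-(s * y) : ℝ) : ℂ) * Complex.I by push_cast; ring]
  exact Complex.norm_exp_ofReal_mul_I _

lemma smooth_bound (hXm : Measurable X) (A K : ℝ) (hK : 0 ≤ K)
    (hInt : Integrable (fun t : ℝ => ‖∫ ω, Complex.exp (Complex.I * (t : ℂ) * (X ω : ℂ)) ∂P‖))
    (hA : (∫ t : ℝ, ‖∫ ω, Complex.exp (Complex.I * (t : ℂ) * (X ω : ℂ)) ∂P‖) = A)
    (h : ℝ → ℂ) (hc : Continuous h) (hb : ∀ x, ‖h x‖ ≤ 1) (v : NNReal) (hv : v ≠ 0) (R : ℝ)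
    (hR : 0 ≤ R)
    (hbd : ∀ s a b : ℝ, a ≤ b → ‖∫ x in a..b, h x * Complex.exp (-(Complex.I * s * x))‖ ≤ K) :
    ‖∫ ω, (∫ x in (-R)..R, h x * ((gaussianPDFReal (X ω) v x : ℝ) : ℂ)) ∂P‖ ≤ K * A := by
  set κ : ℝ := (√(2 * Real.pi * v))⁻¹ with hκ
  have hκ0 : 0 ≤ κ := by positivity
  set γ := gaussianReal 0 v⁻¹ with hγ
  set H : ℝ → ℂ := fun s => ∫ x in (-R)..R, h x * Complex.exp (-(Complex.I * s * x)) with hH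
  have hRR : -R ≤ R := by linarith
  have hHK : ∀ s, ‖H s‖ ≤ K := fun s => hbd s _ _ hRR
  have hHm : StronglyMeasurable H := by
    simp only [hH, intervalIntegral.integral_of_le hRR]
    apply StronglyMeasurable.integral_prod_right (f := fun (s : ℝ) (x : ℝ) => h x * Complex.exp (-(Complex.I * s * x)))
    apply Continuous.stronglyMeasurable
    fun_prop
  have e1 : ∀ ω, ∫ x in (-R)..R, h x * ((gaussianPDFReal (X ω) v x : ℝ) : ℂ) =
      (κ : ℂ) * ∫ s, Complex.exp (Complex.I * s * X ω) * H s ∂γ := by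
    intro ω
    simp only [hH, intervalIntegral.integral_of_le hRR]
    simp_rw [← integral_const_mul]
    rw [integral_integral_swap]
    · congr 1; ext x
      rw [pdf_eq v hv, ← integral_const_mul, ← integral_const_mul]
      congr 1; ext s
      ring
    · refine Integrable.of_bound (C := κ) ?_ ?_
      · apply Continuous.aestronglyMeasurable
        fun_prop
      · refine Filter.Eventually.of_forall fun z => ?_
        simp only [Function.uncurry, norm_mul, nexp, nexp', one_mul, mul_one, Complex.norm_real,
          Real.norm_eq_abs, abs_of_nonneg hκ0]
        nlinarith [hb z.2, norm_nonneg (h z.2)]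
  have e2 : ∫ ω, (∫ x in (-R)..R, h x * ((gaussianPDFReal (X ω) v x : ℝ) : ℂ)) ∂P =
      (κ : ℂ) * ∫ s, (∫ ω, Complex.exp (Complex.I * s * X ω) ∂P) * H s ∂γ := by
    simp_rw [e1]
    rw [integral_const_mul, integral_integral_swap]
    · simp_rw [integral_mul_const]
    · refine Integrable.of_bound (C := K) ?_ ?_
      · apply StronglyMeasurable.aestronglyMeasurable
        apply StronglyMeasurable.mul
        · apply Measurable.stronglyMeasurable
          fun_prop
        · exact hHm.comp_measurable measurable_snd
      · refine Filter.Eventually.of_forall fun z => ?_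
        simp only [Function.uncurry, norm_mul, nexp, one_mul]
        exact hHK _
  rw [e2, hγ, integral_gaussianReal_eq_integral_smul (by simpa using hv), norm_mul, Complex.norm_real,
    Real.norm_of_nonneg hκ0]
  set κ' : ℝ := (√(2 * Real.pi * (v⁻¹ : NNReal)))⁻¹ with hκ'
  have hκ'0 : 0 ≤ κ' := by positivity
  have hpdf : ∀ s, gaussianPDFReal 0 v⁻¹ s ≤ κ' := by
    intro s
    rw [gaussianPDFReal]
    apply mul_le_of_le_one_right hκ'0
    rw [Real.exp_le_one_iff]
    apply div_nonpos_of_nonpos_of_nonneg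
    · nlinarith [sq_nonneg (s - 0)]
    · positivity
  have hkk : κ * κ' ≤ 1 := by
    have hv' : (v : ℝ) ≠ 0 := by exact_mod_cast hv
    rw [hκ, hκ', ← mul_inv, ← Real.sqrt_mul (by positivity)]
    have : 2 * Real.pi * v * (2 * Real.pi * (v⁻¹ : NNReal)) = (2 * Real.pi)^2 := by
      push_cast; field_simp
    rw [this, Real.sqrt_sq (by positivity)]
    apply inv_le_one_of_one_le₀
    linarith [Real.pi_gt_three]
  have hfin : ‖∫ s, gaussianPDFReal 0 v⁻¹ s • ((∫ ω, Complex.exp (Complex.I * s * X ω) ∂P) * H s)‖ ≤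
      κ' * K * A := by
    rw [← hA, ← integral_const_mul]
    apply norm_integral_le_of_norm_le (hInt.const_mul _)
    refine Filter.Eventually.of_forall fun s => ?_
    rw [norm_smul, norm_mul, Real.norm_of_nonneg (gaussianPDFReal_nonneg _ _ _)]
    calc _ ≤ κ' * (‖∫ ω, Complex.exp (Complex.I * s * X ω) ∂P‖ * K) := by
          gcongr
          · exact hpdf s
          · exact hHK s
      _ = _ := by ring
  have hA0 : 0 ≤ A := by rw [← hA]; positivity
  calc _ ≤ κ * (κ' * K * A) := by gcongr
    _ = (κ * κ') * (K * A) := by ring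
    _ ≤ 1 * (K * A) := by gcongr
    _ = K * A := one_mul _

lemma gauss_bound (hXm : Measurable X) (A K : ℝ) (hK : 0 ≤ K)
    (hInt : Integrable (fun t : ℝ => ‖∫ ω, Complex.exp (Complex.I * (t : ℂ) * (X ω : ℂ)) ∂P‖))
    (hA : (∫ t : ℝ, ‖∫ ω, Complex.exp (Complex.I * (t : ℂ) * (X ω : ℂ)) ∂P‖) = A)
    (h : ℝ → ℂ) (hc : Continuous h) (hb : ∀ x, ‖h x‖ ≤ 1) (v : NNReal) (hv : v ≠ 0)
    (hbd : ∀ s a b : ℝ, a ≤ b → ‖∫ x in a..b, h x * Complex.exp (-(Complex.I * s * x))‖ ≤ K) :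
    ‖∫ ω, ∫ x, h x ∂(gaussianReal (X ω) v) ∂P‖ ≤ K * A := by
  have hn : ∀ y x, ‖h x * ((gaussianPDFReal y v x : ℝ) : ℂ)‖ ≤ gaussianPDFReal y v x := by
    intro y x
    rw [norm_mul, Complex.norm_real, Real.norm_of_nonneg (gaussianPDFReal_nonneg _ _ _)]
    exact mul_le_of_le_one_left (gaussianPDFReal_nonneg _ _ _) (hb x)
  have hm : ∀ y, Integrable (fun x => h x * ((gaussianPDFReal y v x : ℝ) : ℂ)) := by
    intro y
    refine (integrable_gaussianPDFReal y v).mono' ?_ (Filter.Eventually.of_forall (hn y))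
    exact hc.aestronglyMeasurable.mul
      (Complex.measurable_ofReal.comp (measurable_gaussianPDFReal y v)).aestronglyMeasurable
  have hlim : Tendsto (fun n : ℕ => ∫ ω, (∫ x in (-(n:ℝ))..n, h x * ((gaussianPDFReal (X ω) v x : ℝ) : ℂ)) ∂P)
      atTop (nhds (∫ ω, ∫ x, h x ∂(gaussianReal (X ω) v) ∂P)) := by
    apply tendsto_integral_of_dominated_convergence (fun _ => 1)
    · intro n
      have hRR : -(n:ℝ) ≤ n := by linarith [Nat.cast_nonneg (α := ℝ) n]
      simp only [intervalIntegral.integral_of_le hRR]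
      apply StronglyMeasurable.aestronglyMeasurable
      apply StronglyMeasurable.integral_prod_right (f := fun (ω : Ω) (x : ℝ) => h x * ((gaussianPDFReal (X ω) v x : ℝ) : ℂ))
      apply Measurable.stronglyMeasurable
      simp only [gaussianPDFReal, Function.uncurry_def]
      fun_prop
    · exact integrable_const _
    · intro n
      refine Filter.Eventually.of_forall fun ω => ?_
      have hRR : -(n:ℝ) ≤ n := by linarith [Nat.cast_nonneg (α := ℝ) n]
      rw [intervalIntegral.integral_of_le hRR]
      refine (norm_integral_le_of_norm_le (integrable_gaussianPDFReal (X ω) v).integrableOn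
        (Filter.Eventually.of_forall (hn (X ω)))).trans ?_
      rw [← integral_gaussianPDFReal_eq_one (X ω) hv]
      exact setIntegral_le_integral (integrable_gaussianPDFReal (X ω) v)
        (Filter.Eventually.of_forall (gaussianPDFReal_nonneg _ _))
    · refine Filter.Eventually.of_forall fun ω => ?_
      rw [integral_gaussianReal_eq_integral_smul hv]
      have := intervalIntegral_tendsto_integral (hm (X ω))
        (tendsto_neg_atTop_atBot.comp (tendsto_natCast_atTop_atTop (R := ℝ))) (tendsto_natCast_atTop_atTop (R := ℝ))
      have e : ∫ x, gaussianPDFReal (X ω) v x • h x = ∫ x, h x * ((gaussianPDFReal (X ω) v x : ℝ) : ℂ) := by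
        congr 1; ext x; rw [Complex.real_smul, mul_comm]
      rw [e]
      exact this
  refine le_of_tendsto hlim.norm (Filter.Eventually.of_forall fun n => ?_)
  exact smooth_bound P X hXm A K hK hInt hA h hc hb v hv n (Nat.cast_nonneg n) hbd

lemma final_bound (hXm : Measurable X) (A K : ℝ) (hK : 0 ≤ K)
    (hInt : Integrable (fun t : ℝ => ‖∫ ω, Complex.exp (Complex.I * (t : ℂ) * (X ω : ℂ)) ∂P‖))
    (hA : (∫ t : ℝ, ‖∫ ω, Complex.exp (Complex.I * (t : ℂ) * (X ω : ℂ)) ∂P‖) = A)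
    (h : ℝ → ℂ) (hc : Continuous h) (hb : ∀ x, ‖h x‖ ≤ 1)
    (hbd : ∀ s a b : ℝ, a ≤ b → ‖∫ x in a..b, h x * Complex.exp (-(Complex.I * s * x))‖ ≤ K) :
    ‖∫ ω, h (X ω) ∂P‖ ≤ K * A := by
  have key : ∀ (e : ℝ), e ≠ 0 →
      ‖∫ ω, ∫ z, h (X ω + e * z) ∂(gaussianReal 0 1) ∂P‖ ≤ K * A := by
    intro e he
    have := gauss_bound P X hXm A K hK hInt hA h hc hb (NNReal.mk (e^2) (sq_nonneg e)) (by
      intro h0; exact he (by simpa using congrArg NNReal.toReal h0)) hbd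
    convert this using 4 with ω
    have h1 : gaussianReal (X ω) (NNReal.mk (e^2) (sq_nonneg e)) = (gaussianReal 0 1).map (fun z => X ω + e * z) := by
      have := gaussianReal_map_const_mul (μ := 0) (v := 1) e
      rw [show (fun z => X ω + e * z) = (fun z => X ω + z) ∘ (fun z => e * z) from rfl,
        ← Measure.map_map (by fun_prop) (by fun_prop), this, gaussianReal_map_const_add]
      simp
    rw [h1, integral_map (by fun_prop) hc.aestronglyMeasurable]
  have hlim : Tendsto (fun n : ℕ => ∫ ω, ∫ z, h (X ω + (1 / ((n:ℝ) + 1)) * z) ∂(gaussianReal 0 1) ∂P)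
      atTop (nhds (∫ ω, h (X ω) ∂P)) := by
    apply tendsto_integral_of_dominated_convergence (fun _ => 1)
    · intro n
      apply StronglyMeasurable.aestronglyMeasurable
      apply StronglyMeasurable.integral_prod_right (f := fun (ω : Ω) (z : ℝ) => h (X ω + (1 / ((n:ℝ) + 1)) * z))
      apply Measurable.stronglyMeasurable
      have := hc.measurable
      simp only [Function.uncurry_def]
      fun_prop
    · exact integrable_const _
    · intro n
      refine Filter.Eventually.of_forall fun ω => ?_
      refine (norm_integral_le_of_norm_le_const (Filter.Eventually.of_forall fun z => hb _)).trans ?_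
      simp
    · refine Filter.Eventually.of_forall fun ω => ?_
      have : h (X ω) = ∫ z, h (X ω) ∂(gaussianReal 0 1) := by simp
      rw [this]
      apply tendsto_integral_of_dominated_convergence (fun _ => 1)
      · intro n
        exact Continuous.aestronglyMeasurable (by fun_prop)
      · exact integrable_const _
      · intro n
        exact Filter.Eventually.of_forall fun z => hb _
      · refine Filter.Eventually.of_forall fun z => ?_
        apply (hc.tendsto _).comp
        have := ((tendsto_one_div_add_atTop_nhds_zero_nat (𝕜 := ℝ)).mul_const z).const_add (X ω)
        simpa using this
  refine le_of_tendsto hlim.norm (Filter.Eventually.of_forall fun n => ?_)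
  exact key _ (by positivity)
end



/-- (Remark 1.) Let `X` be a random variable whose characteristic function
`g_X` satisfies `∫_{-∞}^∞ |g_X(t)| dt = A < ∞`. Then for the monic polynomial
`f(x) = x^m + α_{m-1}x^{m-1} + ⋯ + α₀` of degree `m ≥ 2` there is a constant `c` (not
depending on `t`) with `|E exp(i t f(X))| ≤ c A |t|^{-1/m}` for all `|t| ≥ 1`. -/
theorem stmt_5 {Ω : Type*} [MeasurableSpace Ω] (P : Measure Ω) [IsProbabilityMeasure P]
    (X : Ω → ℝ) (hXm : Measurable X)
    (m : ℕ) (hm : 2 ≤ m) (α : ℕ → ℝ) (A : ℝ)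
    (hInt : Integrable (fun t : ℝ => ‖∫ ω, Complex.exp (Complex.I * (t : ℂ) * (X ω : ℂ)) ∂P‖))
    (hA : (∫ t : ℝ, ‖∫ ω, Complex.exp (Complex.I * (t : ℂ) * (X ω : ℂ)) ∂P‖) = A) :
    ∃ c : ℝ, 0 < c ∧ ∀ t : ℝ, 1 ≤ |t| →
      ‖∫ ω, Complex.exp (Complex.I * (t : ℂ) *
          ((X ω ^ m + ∑ j ∈ Finset.range m, α j * X ω ^ j : ℝ) : ℂ)) ∂P‖ ≤
        c * A * |t| ^ (-(1 : ℝ) / m) := by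

  obtain ⟨C, hC, hosc⟩ := osc m hm α
  refine ⟨C, hC, fun t ht => ?_⟩
  have hn : ∀ y : ℝ, ‖Complex.exp (Complex.I * (t : ℂ) * (y : ℂ))‖ ≤ 1 := fun y => (nexp t y).le
  have := final_bound P X hXm A (C * |t| ^ (-(1:ℝ) / m)) (by positivity) hInt hA
    (fun x => Complex.exp (Complex.I * (t : ℂ) *
          ((x ^ m + ∑ j ∈ Finset.range m, α j * x ^ j : ℝ) : ℂ))) (by fun_prop) (fun x => hn _) (by
      intro s a b hab
      have := hosc t ht s a b hab
      convert this using 3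
      ext x
      rw [← Complex.exp_add]
      congr 1
      push_cast
      ring)
  refine this.trans (le_of_eq (by ring))
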